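/- Let s be a bounded transfinite sequence of reals of indecomposable length greater than 1, and suppose s converges to c ∈ ℝ, i.e., for every ε > 0 there is ζ < ℓ(s) such that |s_(ξ) − c| < ε for all ξ with ζ ≤ ξ < ℓ(s). Then M̄(s) = c. -/

import Mathlib

open Ordinal

/-- The number `n` of full blocks in the standard decomposition `o = ω^σ·n + ρ`,
where `ω^σ = ω ^ log ω o` is the largest indecomposable ordinal `≤ o`. -/
noncomputable def stdBlocks (o : Ordinal.{0}) : ℕ :=
  Cardinal.toNat (o / omega0 ^ log omega0 o).card

/-- The upper mean `M̄` of a transfinite sequence of reals.  A sequence of length `o`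
is encoded as a total function `f : Ordinal → ℝ`; only the values of `f` at ordinals
`< o` are ever used.  It is defined by transfinite recursion on `o`:
(1) for `o = 1` it is `f 0`;
(2) for `o` indecomposable with `o > 1` (i.e. `o = ω^σ` with `σ > 0`) it is
    `limsup_{ξ → o} M̄(f|_ξ) = inf_{1 ≤ ζ < o} sup_{ζ ≤ ξ < o} M̄(f|_ξ)`;
(3) for decomposable `o`, writing `o = ω^σ·n + ρ` with `ρ < ω^σ`, it is the average
    `(1/n) (M̄(s₀) + ⋯ + M̄(s_{n-1}))` of the upper means of the `n` consecutive
    blocks of `f` of length `ω^σ` (the remainder of length `ρ` is discarded). -/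
noncomputable def upperMean (o : Ordinal.{0}) (f : Ordinal.{0} → ℝ) : ℝ :=
  if o = 1 then f 0
  else if h1 : 1 < o ∧ o = omega0 ^ log omega0 o then
    ⨅ ζ : Set.Ico (1 : Ordinal.{0}) o, ⨆ ξ : Set.Ico ζ.1 o, upperMean ξ.1 f
  else if h2 : 1 < o then
    ((stdBlocks o : ℝ))⁻¹ *
      ∑ i ∈ Finset.range (stdBlocks o),
        upperMean (omega0 ^ log omega0 o)
          (fun ξ => f (omega0 ^ log omega0 o * (i : Ordinal) + ξ))
  else 0
termination_by o
decreasing_by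
  · exact ξ.2.2
  · exact lt_of_le_of_ne (opow_log_le_self _ (zero_lt_one.trans h2).ne')
      fun h => h1 ⟨h2, h.symm⟩

/-- A transfinite sequence of reals of length `o` is bounded if its range
(on indices `< o`) is bounded in `ℝ`. -/
def SeqBounded (o : Ordinal.{0}) (f : Ordinal.{0} → ℝ) : Prop :=
  ∃ C : ℝ, ∀ ξ < o, |f ξ| ≤ C

/-- The concatenation `r ⊕ s` of a sequence `r` of length `a` with a sequence `s`:
its first `a` entries are those of `r`, and its entry at `a + ξ'` is `s ξ'`. -/
noncomputable def concatSeq (a : Ordinal.{0}) (r s : Ordinal.{0} → ℝ) :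
    Ordinal.{0} → ℝ :=
  fun ξ => if ξ < a then r ξ else s (ξ - a)

/-- An ordinal is indecomposable if it is nonzero and not the sum of two strictly
smaller ordinals. -/
def IsIndecomposable (o : Ordinal.{0}) : Prop :=
  o ≠ 0 ∧ ∀ b < o, ∀ c < o, b + c ≠ o

/-- The concatenation `s₀ ⊕ s₁ ⊕ ⋯ ⊕ s_{n-1}` of `n` sequences, each of length `β`;
the result has length `β * n`. -/
noncomputable def concatN (β : Ordinal.{0}) :
    (n : ℕ) → (Fin n → Ordinal.{0} → ℝ) → Ordinal.{0} → ℝ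
  | 0, _ => fun _ => 0
  | n + 1, s => concatSeq (β * n) (concatN β n (fun i => s i.castSucc)) (s (Fin.last n))

/-- `s / β`: given a sequence `s` whose length is `β * α`, the sequence of length `α`
whose `ι`-th entry is the upper mean of the `ι`-th consecutive block of `s` of
length `β`. -/
noncomputable def seqDiv (s : Ordinal.{0} → ℝ) (β : Ordinal.{0}) : Ordinal.{0} → ℝ :=
  fun ι => upperMean β (fun ξ => s (β * ι + ξ))

/-- The lower mean `𝕄̲(s) = -M̄(-s)`. -/
noncomputable def lowerMean (o : Ordinal.{0}) (s : Ordinal.{0} → ℝ) : ℝ :=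
  - upperMean o (fun ξ => - s ξ)

/-- A sequence `s` of length `o` has mean `c` when its upper and lower means both
equal `c`. -/
def HasMean (o : Ordinal.{0}) (s : Ordinal.{0} → ℝ) (c : ℝ) : Prop :=
  upperMean o s = c ∧ lowerMean o s = c

theorem natCast_stdBlocks (o : Ordinal.{0}) :
    (stdBlocks o : Ordinal.{0}) = o / omega0 ^ log omega0 o := by
  obtain ⟨n, hn⟩ := lt_omega0.1 (div_opow_log_lt o one_lt_omega0)
  simp [stdBlocks, hn]

theorem stdBlocks_pos {o : Ordinal.{0}} (ho : o ≠ 0) : 0 < stdBlocks o := by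
  have h := div_opow_log_pos omega0 ho
  rw [← natCast_stdBlocks] at h
  exact_mod_cast h

theorem opow_log_mul_stdBlocks_le (o : Ordinal.{0}) :
    omega0 ^ log omega0 o * (stdBlocks o : Ordinal.{0}) ≤ o := by
  rw [natCast_stdBlocks]
  exact mul_div_le _ _

theorem opow_log_mul_add_lt {o ξ : Ordinal.{0}} {i : ℕ} (hi : i < stdBlocks o)
    (hξ : ξ < omega0 ^ log omega0 o) : omega0 ^ log omega0 o * (i : Ordinal.{0}) + ξ < o := by
  refine lt_of_lt_of_le (opow_mul_add_lt_opow_mul hξ ?_) (opow_log_mul_stdBlocks_le o)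
  exact_mod_cast hi

theorem stdBlocks_of_eq_opow_log {o : Ordinal.{0}} (ho : o ≠ 0) (h : o = omega0 ^ log omega0 o) :
    stdBlocks o = 1 := by
  have h1 := natCast_stdBlocks o
  rw [← h, Ordinal.div_self ho] at h1
  exact_mod_cast h1

/-- The averaging formula for the upper mean holds at every nonzero length. -/
theorem upperMean_eq_average {o : Ordinal.{0}} (ho : o ≠ 0) (f : Ordinal.{0} → ℝ) :
    upperMean o f = ((stdBlocks o : ℝ))⁻¹ *
      ∑ i ∈ Finset.range (stdBlocks o),
        upperMean (omega0 ^ log omega0 o)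
          (fun ξ => f (omega0 ^ log omega0 o * (i : Ordinal) + ξ)) := by
  by_cases h : o = omega0 ^ log omega0 o
  · rw [stdBlocks_of_eq_opow_log ho h, ← h]
    simp
  · have h1 : o ≠ 1 := by
      rintro rfl
      simp at h
    have h2 : 1 < o := lt_of_le_of_ne (Order.one_le_iff_ne_zero.2 ho) h1.symm
    rw [upperMean, if_neg h1, dif_neg (fun h' => h h'.2), dif_pos h2]

theorem upperMean_opow {σ : Ordinal.{0}} (hσ : σ ≠ 0) (f : Ordinal.{0} → ℝ) :
    upperMean (omega0 ^ σ) f =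
      ⨅ ζ : Set.Ico (1 : Ordinal.{0}) (omega0 ^ σ), ⨆ ξ : Set.Ico ζ.1 (omega0 ^ σ),
        upperMean ξ.1 f := by
  have h1 : 1 < omega0 ^ σ := one_lt_opow.2 ⟨one_lt_omega0, hσ⟩
  rw [upperMean, if_neg h1.ne', dif_pos ⟨h1, by rw [log_opow one_lt_omega0]⟩]

/-- Bounds for the limsup of a bounded function of the ordinals below `o`. -/
theorem iInf_iSup_Ico_mem_Icc {o : Ordinal.{0}} {g : Ordinal.{0} → ℝ}
    {A B a b : ℝ} (hg : ∀ ξ, 1 ≤ ξ → ξ < o → g ξ ∈ Set.Icc A B)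
    (h : ∀ δ > 0, ∃ ζ, 1 ≤ ζ ∧ ζ < o ∧ ∀ ξ, ζ ≤ ξ → ξ < o → g ξ ∈ Set.Icc (a - δ) (b + δ)) :
    (⨅ ζ : Set.Ico (1 : Ordinal.{0}) o, ⨆ ξ : Set.Ico ζ.1 o, g ξ.1) ∈ Set.Icc a b := by
  have hbdd (ζ : Set.Ico (1 : Ordinal.{0}) o) :
      BddAbove (Set.range fun ξ : Set.Ico ζ.1 o => g ξ.1) := by
    refine ⟨B, ?_⟩
    rintro _ ⟨ξ, rfl⟩
    exact (hg _ (ζ.2.1.trans ξ.2.1) ξ.2.2).2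
  have hbelow : BddBelow (Set.range
      fun ζ : Set.Ico (1 : Ordinal.{0}) o => ⨆ ξ : Set.Ico ζ.1 o, g ξ.1) := by
    refine ⟨A, ?_⟩
    rintro _ ⟨ζ, rfl⟩
    exact (hg _ ζ.2.1 ζ.2.2).1.trans (le_ciSup (hbdd ζ) ⟨ζ.1, le_rfl, ζ.2.2⟩)
  constructor
  · refine le_of_forall_pos_sub_le fun δ hδ => ?_
    obtain ⟨ζ, h1, h2, h3⟩ := h δ hδ
    have : Nonempty (Set.Ico (1 : Ordinal.{0}) o) := ⟨⟨ζ, h1, h2⟩⟩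
    refine le_ciInf fun η => ?_
    have hm : max ζ η.1 < o := max_lt h2 η.2.2
    exact (h3 _ (le_max_left _ _) hm).1.trans
      (le_ciSup (hbdd η) ⟨max ζ η.1, le_max_right _ _, hm⟩)
  · refine le_of_forall_pos_le_add fun δ hδ => ?_
    obtain ⟨ζ, h1, h2, h3⟩ := h δ hδ
    have : Nonempty (Set.Ico ζ o) := ⟨⟨ζ, le_rfl, h2⟩⟩
    exact (ciInf_le hbelow ⟨ζ, h1, h2⟩).trans (ciSup_le fun ξ => (h3 _ ξ.2.1 ξ.2.2).2)

theorem inv_mul_sum_range_le {n k : ℕ} (hn : 0 < n) {x : ℕ → ℝ} {b D : ℝ} (hD : 0 ≤ D)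
    (hx : ∀ i < n, x i ≤ b + D) (hk : ∀ i < n, k ≤ i → x i ≤ b) :
    (n : ℝ)⁻¹ * ∑ i ∈ Finset.range n, x i ≤ b + k * D / n := by
  have hn' : (0 : ℝ) < n := by exact_mod_cast hn
  have h1 : ∑ i ∈ Finset.range n, x i ≤
      ∑ i ∈ Finset.range n, (b + if i < k then D else 0) := by
    refine Finset.sum_le_sum fun i hi => ?_
    have hi := Finset.mem_range.1 hi
    split_ifs with h
    · exact hx i hi
    · simpa using hk i hi (not_lt.1 h)
  have h2 : ∑ i ∈ Finset.range n, (if i < k then D else 0) ≤ k * D := by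
    rw [← Finset.sum_filter, Finset.sum_const, _root_.nsmul_eq_mul]
    refine mul_le_mul_of_nonneg_right ?_ hD
    have : Finset.filter (· < k) (Finset.range n) ⊆ Finset.range k := fun i hi => by
      simpa using (Finset.mem_filter.1 hi).2
    simpa using Finset.card_le_card this
  rw [Finset.sum_add_distrib, Finset.sum_const, Finset.card_range, _root_.nsmul_eq_mul] at h1
  rw [inv_mul_le_iff₀ hn']
  have : (n : ℝ) * (b + k * D / n) = n * b + k * D := by field_simp
  linarith

theorem inv_mul_sum_range_mem_Icc {n k : ℕ} (hn : 0 < n) {x : ℕ → ℝ} {a b D : ℝ} (hD : 0 ≤ D)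
    (hx : ∀ i < n, x i ∈ Set.Icc (a - D) (b + D)) (hk : ∀ i < n, k ≤ i → x i ∈ Set.Icc a b) :
    (n : ℝ)⁻¹ * ∑ i ∈ Finset.range n, x i ∈ Set.Icc (a - k * D / n) (b + k * D / n) := by
  refine ⟨?_, inv_mul_sum_range_le hn hD (fun i hi => (hx i hi).2) fun i hi h => (hk i hi h).2⟩
  have h := inv_mul_sum_range_le (x := fun i => -x i) (b := -a) (k := k) hn hD
    (fun i hi => by linarith [(hx i hi).1]) (fun i hi h => by linarith [(hk i hi h).1])
  rw [Finset.sum_neg_distrib] at h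
  linarith

theorem opow_log_lt {σ ξ : Ordinal.{0}} (h0 : ξ ≠ 0) (h : ξ < omega0 ^ σ) :
    log omega0 ξ < σ :=
  (lt_opow_iff_log_lt one_lt_omega0 h0).1 h

/-- The upper mean respects bounds on the entries. -/
theorem upperMean_mem_Icc {o : Ordinal.{0}} (ho : o ≠ 0) {f : Ordinal.{0} → ℝ} {a b : ℝ}
    (hf : ∀ ξ < o, f ξ ∈ Set.Icc a b) : upperMean o f ∈ Set.Icc a b := by
  induction o using WellFoundedLT.induction generalizing f with
  | ind o ih =>
    by_cases h : o = omega0 ^ log omega0 o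
    · by_cases hl : log omega0 o = 0
      · rw [hl, opow_zero] at h
        subst h
        rw [upperMean, if_pos rfl]
        exact hf 0 zero_lt_one
      · rw [h, upperMean_opow hl, ← h]
        have key (ξ) (h1 : 1 ≤ ξ) (h2 : ξ < o) : upperMean ξ f ∈ Set.Icc a b :=
          ih ξ h2 (Order.one_le_iff_ne_zero.1 h1) fun η hη => hf η (hη.trans h2)
        refine iInf_iSup_Ico_mem_Icc key fun δ hδ => ⟨1, le_rfl, ?_, fun ξ h1 h2 => ?_⟩
        · rw [h]
          exact one_lt_opow.2 ⟨one_lt_omega0, hl⟩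
        · exact Set.Icc_subset_Icc (by linarith) (by linarith) (key ξ h1 h2)
    · have hlt := lt_of_le_of_ne (opow_log_le_self omega0 ho) (Ne.symm h)
      have hb : ∀ i < stdBlocks o, upperMean (omega0 ^ log omega0 o)
          (fun ξ => f (omega0 ^ log omega0 o * (i : Ordinal) + ξ)) ∈ Set.Icc a b :=
        fun i hi => ih _ hlt (opow_pos _ omega0_pos).ne'
          fun ξ hξ => hf _ (opow_log_mul_add_lt hi hξ)
      rw [upperMean_eq_average ho]
      simpa using inv_mul_sum_range_mem_Icc (k := 0) (D := 0) (stdBlocks_pos ho) le_rfl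
        (by simpa using hb) (fun i hi _ => hb i hi)

/-- At indecomposable lengths greater than `1` the upper mean respects eventual bounds. -/
theorem upperMean_opow_mem_Icc_of_eventually {σ : Ordinal.{0}} (hσ : σ ≠ 0)
    {f : Ordinal.{0} → ℝ} {a b D : ℝ} (hD : 0 ≤ D)
    (hf : ∀ ξ < omega0 ^ σ, f ξ ∈ Set.Icc (a - D) (b + D))
    {ζ : Ordinal.{0}} (hζ : ζ < omega0 ^ σ)
    (hev : ∀ ξ, ζ ≤ ξ → ξ < omega0 ^ σ → f ξ ∈ Set.Icc a b) :
    upperMean (omega0 ^ σ) f ∈ Set.Icc a b := by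
  induction σ using WellFoundedLT.induction generalizing f ζ with
  | ind σ ih =>
    wlog hζ0 : ζ ≠ 0 generalizing ζ
    · exact this (one_lt_opow.2 ⟨one_lt_omega0, hσ⟩)
        (fun ξ _ h2 => hev ξ (by simp [not_not.1 hζ0]) h2) one_ne_zero
    have hlog := opow_log_lt hζ0 hζ
    obtain ⟨k, hk⟩ : ∃ k : ℕ, ζ < omega0 ^ log omega0 ζ * k :=
      lt_omega0_opow_succ.1 (lt_opow_succ_log_self one_lt_omega0 ζ)
    rw [upperMean_opow hσ]
    refine iInf_iSup_Ico_mem_Icc (fun ξ h1 h2 => upperMean_mem_Icc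
      (Order.one_le_iff_ne_zero.1 h1) fun η hη => hf η (hη.trans h2)) fun δ hδ => ?_
    obtain ⟨N, hN⟩ := exists_nat_gt (k * D / δ)
    refine ⟨omega0 ^ log omega0 ζ * (N + 1 : ℕ), ?_, ?_, fun ξ h1 h2 => ?_⟩
    · rw [Order.one_le_iff_ne_zero]
      exact mul_ne_zero (opow_pos _ omega0_pos).ne' (by exact_mod_cast N.succ_ne_zero)
    · simpa using opow_mul_add_lt_opow (natCast_lt_omega0 (N + 1)) (opow_pos _ omega0_pos) hlog
    have hξ0 : ξ ≠ 0 := by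
      rintro rfl
      exact mul_ne_zero (opow_pos _ omega0_pos).ne' (by exact_mod_cast N.succ_ne_zero)
        (nonpos_iff_eq_zero.1 h1)
    have hn := stdBlocks_pos hξ0
    have hξσ := opow_log_lt hξ0 h2
    have hle : log omega0 ζ ≤ log omega0 ξ := by
      rw [← opow_le_iff_le_log one_lt_omega0 hξ0]
      refine le_trans (le_mul_of_one_le_right' ?_) h1
      exact_mod_cast Nat.le_add_left 1 N
    have hlt {i : ℕ} (hi : i < stdBlocks ξ) {η} (hη : η < omega0 ^ log omega0 ξ) :=
      (opow_log_mul_add_lt hi hη).trans h2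
    have hbound (i) (hi : i < stdBlocks ξ) : upperMean (omega0 ^ log omega0 ξ)
          (fun η => f (omega0 ^ log omega0 ξ * (i : Ordinal) + η)) ∈ Set.Icc (a - D) (b + D) :=
      upperMean_mem_Icc (opow_pos _ omega0_pos).ne' fun η hη => hf _ (hlt hi hη)
    rw [upperMean_eq_average hξ0]
    rcases hle.eq_or_lt with heq | hlog'
    · have hblock (i) (hi : i < stdBlocks ξ) (hki : k ≤ i) : upperMean (omega0 ^ log omega0 ξ)
          (fun η => f (omega0 ^ log omega0 ξ * (i : Ordinal) + η)) ∈ Set.Icc a b := by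
        refine upperMean_mem_Icc (opow_pos _ omega0_pos).ne' fun η hη => hev _ ?_ (hlt hi hη)
        rw [← heq]
        refine hk.le.trans (le_trans ?_ le_self_add)
        gcongr
      have hNn : N + 1 ≤ stdBlocks ξ := by
        rw [heq, mul_le_iff_le_div (opow_pos _ omega0_pos).ne', ← natCast_stdBlocks] at h1
        exact_mod_cast h1
      have hn' : (0 : ℝ) < stdBlocks ξ := by exact_mod_cast hn
      have hNn' : (N : ℝ) + 1 ≤ stdBlocks ξ := by exact_mod_cast hNn
      have hsmall : k * D / stdBlocks ξ ≤ δ := by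
        rw [div_lt_iff₀ hδ] at hN
        rw [div_le_iff₀ hn']
        nlinarith
      exact Set.Icc_subset_Icc (by linarith) (by linarith)
        (inv_mul_sum_range_mem_Icc hn hD hbound hblock)
    · have hζlt : ζ < omega0 ^ log omega0 ξ := (lt_opow_iff_log_lt one_lt_omega0 hζ0).2 hlog'
      have hblock (i) (hi : i < stdBlocks ξ) : upperMean (omega0 ^ log omega0 ξ)
          (fun η => f (omega0 ^ log omega0 ξ * (i : Ordinal) + η)) ∈ Set.Icc a b :=
        ih _ hξσ (bot_lt_of_lt hlog').ne' (fun η hη => hf _ (hlt hi hη)) hζlt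
          fun η h3 h4 => hev _ (h3.trans le_add_self) (hlt hi h4)
      have := inv_mul_sum_range_mem_Icc (k := 0) (D := D) hn hD hbound (fun i hi _ => hblock i hi)
      simp only [Nat.cast_zero, zero_mul, _root_.zero_div, _root_.sub_zero, add_zero] at this
      exact Set.Icc_subset_Icc (by linarith) (by linarith) this

/-- If `s` is a bounded sequence of indecomposable length `o > 1`
converging to `c` (for every `ε > 0` there is `ζ < o` with `|s ξ - c| < ε` for all
`ζ ≤ ξ < o`), then `M̄(s) = c`. -/
theorem upperMean_of_converges (o : Ordinal.{0}) (ho : 1 < o)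
    (hind : IsIndecomposable o)
    (s : Ordinal.{0} → ℝ) (hs : SeqBounded o s) (c : ℝ)
    (hconv : ∀ ε > (0 : ℝ), ∃ ζ < o, ∀ ξ, ζ ≤ ξ → ξ < o → |s ξ - c| < ε) :
    upperMean o s = c := by
  obtain ⟨σ, rfl⟩ : ∃ σ : Ordinal.{0}, o = omega0 ^ σ := by
    have hp := isPrincipal_add_iff_add_lt_ne_self.2 hind.2
    rcases isPrincipal_add_iff_zero_or_omega0_opow.1 hp with h | ⟨σ, hσ⟩
    · exact absurd h hind.1
    · exact ⟨σ, hσ.symm⟩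
  have hσ : σ ≠ 0 := by
    rintro rfl
    simp at ho
  obtain ⟨C, hC⟩ := hs
  have key (ε : ℝ) (hε : 0 < ε) : upperMean (omega0 ^ σ) s ∈ Set.Icc (c - ε) (c + ε) := by
    obtain ⟨ζ, hζ, hev⟩ := hconv ε hε
    refine upperMean_opow_mem_Icc_of_eventually hσ (D := |C| + |c|) (by positivity)
      (fun ξ hξ => ?_) hζ (fun ξ h1 h2 => ?_)
    · have h1 := abs_le.1 (hC ξ hξ)
      have h2 := le_abs_self C
      have h3 := abs_le.1 (le_refl |c|)
      constructor <;> linarith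
    · have := abs_lt.1 (hev ξ h1 h2)
      constructor <;> linarith
  exact le_antisymm (le_of_forall_pos_le_add fun ε hε => (key ε hε).2)
    (le_of_forall_pos_sub_le fun ε hε => (key ε hε).1)
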